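/- arXiv:2310.05898 — 4 statements merged into one kernel-verified Lean document; each statement's English description precedes it below -/
import Mathlib

section
/- Let (x_t, m_t) be a continuously differentiable solution of the Lion-φ ODE: ẋ_t = ∇φ(m_t − ε(α∇f(x_t) + γ m_t)) − λ x_t, ṁ_t = −α∇f(x_t) − γ m_t, with α, γ, λ, ε > 0. Let dom φ* = {y : φ*(y) < +∞} and define dist(y, dom φ*) = inf_{z ∈ dom φ*} ‖z − y‖ with respect to any norm ‖·‖ on ℝ^d. Then for all 0 ≤ s ≤ t, dist(λ x_t, dom φ*) ≤ exp(−λ(t − s)) · dist(λ x_s, dom φ*). In particular λ x_t converges linearly to dom φ* and remains in dom φ* once it enters it. -/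
open scoped RealInnerProductSpace

/-- The convex (Fenchel) conjugate `φ*(y) = sup_z (yᵀz − φ(z))`,
valued in the extended reals. -/
noncomputable def fenchelConj {d : ℕ} (φ : EuclideanSpace ℝ (Fin d) → ℝ)
    (y : EuclideanSpace ℝ (Fin d)) : EReal :=
  ⨆ z : EuclideanSpace ℝ (Fin d), ((⟪y, z⟫ - φ z : ℝ) : EReal)

/-- The effective domain of the conjugate, `dom φ* = {y : φ*(y) < +∞}`. -/
def fenchelDom {d : ℕ} (φ : EuclideanSpace ℝ (Fin d) → ℝ) :
    Set (EuclideanSpace ℝ (Fin d)) :=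
  {y | fenchelConj φ y ≠ ⊤}

theorem mem_fenchelDom_iff {d : ℕ} {φ : EuclideanSpace ℝ (Fin d) → ℝ}
    {y : EuclideanSpace ℝ (Fin d)} :
    y ∈ fenchelDom φ ↔ ∃ C : ℝ, ∀ w, ⟪y, w⟫ - φ w ≤ C := by
  constructor
  · intro hy
    refine ⟨(fenchelConj φ y).toReal, fun w => ?_⟩
    have hle : ((⟪y, w⟫ - φ w : ℝ) : EReal) ≤ fenchelConj φ y :=
      le_iSup (fun z => ((⟪y, z⟫ - φ z : ℝ) : EReal)) w
    exact EReal.coe_le_coe_iff.mp (hle.trans (EReal.le_coe_toReal hy))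
  · rintro ⟨C, hC⟩
    exact ((iSup_le fun w => EReal.coe_le_coe_iff.mpr (hC w)).trans_lt (EReal.coe_lt_top C)).ne

/-- The gradient inequality for differentiable convex functions. -/
theorem ConvexOn.add_inner_gradient_le {E : Type*} [NormedAddCommGroup E]
    [InnerProductSpace ℝ E] [CompleteSpace E] {φ : E → ℝ} (hconv : ConvexOn ℝ Set.univ φ)
    {g z : E} (hg : HasGradientAt φ g z) (w : E) : φ z + ⟪g, w - z⟫ ≤ φ w := by
  have hline : HasDerivAt (fun r : ℝ => AffineMap.lineMap z w r) (w - z) 0 :=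
    AffineMap.hasDerivAt_lineMap
  have hg' : HasFDerivAt φ (InnerProductSpace.toDual ℝ E g)
      (AffineMap.lineMap z w (0 : ℝ)) := by
    simpa using hg.hasFDerivAt
  have hderiv := hg'.comp_hasDerivAt (0 : ℝ) hline
  have hcomp : ConvexOn ℝ Set.univ (φ ∘ fun r : ℝ => AffineMap.lineMap z w r) :=
    hconv.comp_affineMap (AffineMap.lineMap z w)
  have hslope := hcomp.le_slope_of_hasDerivAt (Set.mem_univ 0) (Set.mem_univ 1) one_pos hderiv
  simp [slope_def_field] at hslope
  linarith

/-- A uniform version of `∇φ(z) ∈ dom φ*`, with a bound depending continuously on `z`. -/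
theorem ConvexOn.inner_gradient_sub_le {E : Type*} [NormedAddCommGroup E]
    [InnerProductSpace ℝ E] [CompleteSpace E] {φ : E → ℝ} (hconv : ConvexOn ℝ Set.univ φ)
    {g z : E} (hg : HasGradientAt φ g z) (w : E) :
    ⟪g, w⟫ - φ w ≤ φ ((2 : ℝ) • z) - 2 * φ z := by
  have h₁ := hconv.add_inner_gradient_le hg w
  have h₂ := hconv.add_inner_gradient_le hg ((2 : ℝ) • z)
  rw [inner_sub_right] at h₁ h₂
  rw [inner_smul_right] at h₂
  linarith

theorem nonpos_of_hasDerivAt_le_neg_mul {lam s t : ℝ} (hst : s ≤ t) {h h' : ℝ → ℝ}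
    (hh : ∀ r, HasDerivAt h (h' r) r) (hle : ∀ r ∈ Set.Icc s t, h' r ≤ -lam * h r)
    (hs : h s ≤ 0) : h t ≤ 0 := by
  have hexp : ∀ r, HasDerivAt (fun r => h r * Real.exp (lam * r))
      (h' r * Real.exp (lam * r) + h r * (Real.exp (lam * r) * lam)) r := fun r => by
    have := ((hasDerivAt_id r).const_mul lam).exp
    simpa using! (hh r).mul this
  have hanti : AntitoneOn (fun r => h r * Real.exp (lam * r)) (Set.Icc s t) := by
    refine antitoneOn_of_deriv_nonpos (convex_Icc s t)
      (fun r _ => (hexp r).continuousAt.continuousWithinAt)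
      (fun r _ => (hexp r).differentiableAt.differentiableWithinAt) fun r hr => ?_
    rw [(hexp r).deriv]
    nlinarith [hle r (interior_subset hr), Real.exp_pos (lam * r)]
  have hend := hanti (Set.left_mem_Icc.mpr hst) (Set.right_mem_Icc.mpr hst) hst
  have hstart : h s * Real.exp (lam * s) ≤ 0 :=
    mul_nonpos_of_nonpos_of_nonneg hs (Real.exp_pos _).le
  exact nonpos_of_mul_nonpos_left (hend.trans hstart) (Real.exp_pos _)

/-- The domain `dom φ*` is forward invariant under `q̇ = λ (∇φ(z_t) − q)`
for every continuous path `z`. -/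
theorem mem_fenchelDom_of_hasDerivAt {d : ℕ} {φ : EuclideanSpace ℝ (Fin d) → ℝ}
    {φ' : EuclideanSpace ℝ (Fin d) → EuclideanSpace ℝ (Fin d)}
    (hconv : ConvexOn ℝ Set.univ φ) (hφ' : ∀ z, HasGradientAt φ (φ' z) z)
    {lam : ℝ} (hlam : 0 ≤ lam) {z q : ℝ → EuclideanSpace ℝ (Fin d)} (hz : Continuous z)
    (hq : ∀ r, HasDerivAt q (lam • (φ' (z r) - q r)) r) {s t : ℝ} (hst : s ≤ t)
    (hs : q s ∈ fenchelDom φ) : q t ∈ fenchelDom φ := by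
  have hφ : Continuous φ :=
    continuous_iff_continuousAt.mpr fun w => (hφ' w).hasFDerivAt.continuousAt
  obtain ⟨B, hB⟩ := isCompact_Icc.bddAbove_image (K := Set.Icc s t)
    (f := fun r => φ ((2 : ℝ) • z r) - 2 * φ (z r)) (by fun_prop)
  obtain ⟨A, hA⟩ := mem_fenchelDom_iff.mp hs
  refine mem_fenchelDom_iff.mpr ⟨max A B, fun w => sub_nonpos.mp ?_⟩
  refine nonpos_of_hasDerivAt_le_neg_mul (lam := lam) hst
    (h := fun r => ⟪q r, w⟫ - φ w - max A B)
    (h' := fun r => ⟪lam • (φ' (z r) - q r), w⟫) (fun r => ?_) (fun r hr => ?_)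
    (sub_nonpos.mpr ((hA w).trans (le_max_left A B)))
  · have := (hq r).inner ℝ (hasDerivAt_const r w)
    simpa using (this.sub_const (φ w)).sub_const (max A B)
  · have hg := ((hconv.inner_gradient_sub_le (hφ' (z r)) w).trans
      (hB (Set.mem_image_of_mem _ hr))).trans (le_max_right A B)
    simp only [real_inner_smul_left, inner_sub_left]
    nlinarith

/-- Phase 1 of the Lion-φ ODE: along any continuously differentiable
solution of `ẋ = ∇φ(m − ε(α∇f(x) + γm)) − λx`, `ṁ = −α∇f(x) − γm` with
`α, γ, λ, ε > 0`, the distance from `λ x_t` to `dom φ*` decays at the linear rate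
`dist(λx_t, dom φ*) ≤ exp(−λ(t−s)) dist(λx_s, dom φ*)` for `0 ≤ s ≤ t`; in particular
`λ x_t` remains in `dom φ*` once it enters it. -/
theorem lion_phase_one_ode {d : ℕ}
    (φ f : EuclideanSpace ℝ (Fin d) → ℝ)
    (φ' f' : EuclideanSpace ℝ (Fin d) → EuclideanSpace ℝ (Fin d))
    (hconv : ConvexOn ℝ Set.univ φ)
    (hφ' : ∀ z, HasGradientAt φ (φ' z) z)
    (hf' : ∀ z, HasGradientAt f (f' z) z) (hf'c : Continuous f')
    (α γ lam ε : ℝ) (hα : 0 < α) (hγ : 0 < γ) (hlam : 0 < lam) (hε : 0 < ε)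
    (x m : ℝ → EuclideanSpace ℝ (Fin d))
    (hx : ∀ t, HasDerivAt x
        (φ' (m t - ε • (α • f' (x t) + γ • m t)) - lam • x t) t)
    (hm : ∀ t, HasDerivAt m (-(α • f' (x t)) - γ • m t) t) :
    (∀ s t : ℝ, 0 ≤ s → s ≤ t →
        Metric.infDist (lam • x t) (fenchelDom φ)
          ≤ Real.exp (-lam * (t - s)) * Metric.infDist (lam • x s) (fenchelDom φ))
    ∧ (∀ s t : ℝ, 0 ≤ s → s ≤ t →
        lam • x s ∈ fenchelDom φ → lam • x t ∈ fenchelDom φ) := by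
  have hxc : Continuous x := continuous_iff_continuousAt.mpr fun t => (hx t).continuousAt
  have hmc : Continuous m := continuous_iff_continuousAt.mpr fun t => (hm t).continuousAt
  have hz : Continuous fun t => m t - ε • (α • f' (x t) + γ • m t) := by fun_prop
  have hinv : ∀ s t : ℝ, s ≤ t → ∀ p ∈ fenchelDom φ,
      lam • x t - Real.exp (-lam * (t - s)) • (lam • x s - p) ∈ fenchelDom φ := by
    intro s t hst p hp
    refine mem_fenchelDom_of_hasDerivAt hconv hφ' hlam.le hz
      (q := fun r => lam • x r - Real.exp (-lam * (r - s)) • (lam • x s - p))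
      (fun r => ?_) hst (by simpa using hp)
    have hexp : HasDerivAt (fun r => Real.exp (-lam * (r - s)))
        (Real.exp (-lam * (r - s)) * -lam) r := by
      simpa using (((hasDerivAt_id r).sub_const s).const_mul (-lam)).exp
    refine (((hx r).const_smul lam).sub (hexp.smul_const (lam • x s - p))).congr_deriv ?_
    module
  have hne : (fenchelDom φ).Nonempty :=
    ⟨φ' 0, mem_fenchelDom_iff.mpr ⟨_, hconv.inner_gradient_sub_le (hφ' 0)⟩⟩
  refine ⟨fun s t _ hst => ?_, fun s t _ hst hs => by simpa using hinv s t hst _ hs⟩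
  have hpos := Real.exp_pos (-lam * (t - s))
  rw [← div_le_iff₀' hpos, Metric.le_infDist hne]
  intro p hp
  rw [div_le_iff₀' hpos]
  refine (Metric.infDist_le_dist_of_mem (hinv s t hst p hp)).trans_eq ?_
  rw [dist_eq_norm, sub_sub_cancel, norm_smul, Real.norm_of_nonneg hpos.le, dist_eq_norm]
end

section
/- Let (x_t, m_t) be a continuously differentiable solution of the Lion-φ ODE: ẋ_t = ∇φ(m̃_t) − λ x_t with m̃_t = m_t − ε(α∇f(x_t) + γ m_t), and ṁ_t = −α∇f(x_t) − γ m_t, where α, γ, λ, ε > 0 and εγ ≤ 1. Define H(x,m) = α f(x) + (γ/λ) φ*(λx) + ((1−εγ)/(1+ελ)) ( φ*(λx) + φ(m) − λ mᵀx ). On any time interval where H(x_t,m_t) is finite and continuously differentiable (with φ* differentiable at λx_t), one has −(d/dt) H(x_t, m_t) = ((λ+γ)/(1+ελ)) Δ₁(x_t, m̃_t) + ((1−εγ)/(1+ελ)) Δ₂(m_t, m̃_t) ≥ 0, where Δ₁(x, m̃) = (m̃ − ∇φ*(λx))ᵀ(∇φ(m̃) − λx) ≥ 0 and Δ₂(m,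 m̃) = (1/ε)(m̃ − m)ᵀ(∇φ(m̃) − ∇φ(m)) ≥ 0. Hence H(x_t,m_t) is monotonically non-increasing along trajectories. -/
open scoped RealInnerProductSpace

/-- `v` is a subgradient of the conjugate `φ*` at `y`. -/
def IsConjSubgrad {d : ℕ} (φ : EuclideanSpace ℝ (Fin d) → ℝ)
    (v y : EuclideanSpace ℝ (Fin d)) : Prop :=
  ∀ w, fenchelConj φ y + ((⟪v, w - y⟫ : ℝ) : EReal) ≤ fenchelConj φ w

/-- The gradient of a convex function is monotone. -/
theorem ConvexOn.inner_gradient_sub_nonneg {E : Type*} [NormedAddCommGroup E]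
    [InnerProductSpace ℝ E] [CompleteSpace E] {φ : E → ℝ} (hconv : ConvexOn ℝ Set.univ φ)
    {g h z w : E} (hg : HasGradientAt φ g z) (hh : HasGradientAt φ h w) :
    0 ≤ ⟪z - w, g - h⟫ := by
  have h₁ := hconv.add_inner_gradient_le hg w
  have h₂ := hconv.add_inner_gradient_le hh z
  simp only [inner_sub_right, real_inner_comm g, real_inner_comm h] at *
  linarith

/-- The Fenchel–Young inequality. -/
theorem inner_sub_le_fenchelConj {d : ℕ} (φ : EuclideanSpace ℝ (Fin d) → ℝ)
    (y z : EuclideanSpace ℝ (Fin d)) : ((⟪y, z⟫ - φ z : ℝ) : EReal) ≤ fenchelConj φ y :=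
  le_iSup (fun z => ((⟪y, z⟫ - φ z : ℝ) : EReal)) z

/-- Equality case of Fenchel–Young at a gradient. -/
theorem fenchelConj_gradient {d : ℕ} {φ : EuclideanSpace ℝ (Fin d) → ℝ}
    (hconv : ConvexOn ℝ Set.univ φ) {g z : EuclideanSpace ℝ (Fin d)}
    (hg : HasGradientAt φ g z) : fenchelConj φ g = ((⟪g, z⟫ - φ z : ℝ) : EReal) := by
  refine le_antisymm (iSup_le fun w => EReal.coe_le_coe_iff.2 ?_) (inner_sub_le_fenchelConj φ g z)
  have h := hconv.add_inner_gradient_le hg w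
  rw [inner_sub_right] at h
  linarith

/-- Monotonicity pairing between `∇φ` and a subgradient of the conjugate. -/
theorem IsConjSubgrad.inner_sub_nonneg {d : ℕ} {φ : EuclideanSpace ℝ (Fin d) → ℝ}
    (hconv : ConvexOn ℝ Set.univ φ) {g z v y : EuclideanSpace ℝ (Fin d)}
    (hg : HasGradientAt φ g z) (hv : IsConjSubgrad φ v y) : 0 ≤ ⟪z - v, g - y⟫ := by
  have h := (add_le_add_left (inner_sub_le_fenchelConj φ y z) _).trans (hv g)
  rw [fenchelConj_gradient hconv hg, ← EReal.coe_add, EReal.coe_le_coe_iff] at h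
  rw [inner_sub_left, inner_sub_right z, real_inner_comm g z, real_inner_comm y z]
  linarith

/-- Chain rule for a function with a gradient along a curve. -/
theorem HasGradientAt.comp_hasDerivAt {E : Type*} [NormedAddCommGroup E] [InnerProductSpace ℝ E]
    [CompleteSpace E] {F : E → ℝ} {g : E} {u : ℝ → E} {u' : E} {t : ℝ}
    (hF : HasGradientAt F g (u t)) (hu : HasDerivAt u u' t) :
    HasDerivAt (fun τ => F (u τ)) ⟪g, u'⟫ t := by
  simpa [Function.comp_def] using hF.hasFDerivAt.comp_hasDerivAt t hu

/-- Phase 2 of the Lion-φ ODE: along a solution of the Lion-φ ODE,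
on a time interval `I` on which `φ*(λ x_t)` is finite (with real value `φs(λ x_t)`)
and differentiable (with gradient `φs'(λ x_t)`), the Lyapunov function
`H(x,m) = α f(x) + (γ/λ) φ*(λx) + ((1−εγ)/(1+ελ)) (φ*(λx) + φ(m) − λ mᵀx)`
satisfies `−(d/dt) H(x_t,m_t) = ((λ+γ)/(1+ελ)) Δ₁ + ((1−εγ)/(1+ελ)) Δ₂` with
`Δ₁ = (m̃ − ∇φ*(λx))ᵀ(∇φ(m̃) − λx) ≥ 0` and
`Δ₂ = (1/ε)(m̃ − m)ᵀ(∇φ(m̃) − ∇φ(m)) ≥ 0`, where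
`m̃ = m − ε(α∇f(x) + γm)`; hence `H` is non-increasing along trajectories. -/
theorem lion_lyapunov_descent_ode {d : ℕ}
    (φ f : EuclideanSpace ℝ (Fin d) → ℝ)
    (φ' f' : EuclideanSpace ℝ (Fin d) → EuclideanSpace ℝ (Fin d))
    (φs : EuclideanSpace ℝ (Fin d) → ℝ)
    (φs' : EuclideanSpace ℝ (Fin d) → EuclideanSpace ℝ (Fin d))
    (hconv : ConvexOn ℝ Set.univ φ)
    (hφ' : ∀ z, HasGradientAt φ (φ' z) z)
    (hf' : ∀ z, HasGradientAt f (f' z) z) (hf'c : Continuous f')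
    (α γ lam ε : ℝ) (hα : 0 < α) (hγ : 0 < γ) (hlam : 0 < lam) (hε : 0 < ε)
    (hεγ : ε * γ ≤ 1)
    (x m : ℝ → EuclideanSpace ℝ (Fin d))
    (hx : ∀ t, HasDerivAt x
        (φ' (m t - ε • (α • f' (x t) + γ • m t)) - lam • x t) t)
    (hm : ∀ t, HasDerivAt m (-(α • f' (x t)) - γ • m t) t)
    (I : Set ℝ) (hI : IsOpen I)
    (hfin : ∀ t ∈ I, fenchelConj φ (lam • x t) = ((φs (lam • x t) : ℝ) : EReal))
    (hφs' : ∀ t ∈ I, HasGradientAt φs (φs' (lam • x t)) (lam • x t))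
    (hsub : ∀ t ∈ I, IsConjSubgrad φ (φs' (lam • x t)) (lam • x t))
    (t : ℝ) (ht : t ∈ I) :
    0 ≤ ⟪(m t - ε • (α • f' (x t) + γ • m t)) - φs' (lam • x t),
          φ' (m t - ε • (α • f' (x t) + γ • m t)) - lam • x t⟫
    ∧ 0 ≤ (1 / ε) * ⟪(m t - ε • (α • f' (x t) + γ • m t)) - m t,
          φ' (m t - ε • (α • f' (x t) + γ • m t)) - φ' (m t)⟫
    ∧ HasDerivAt
        (fun τ => α * f (x τ) + (γ / lam) * φs (lam • x τ)
            + ((1 - ε * γ) / (1 + ε * lam)) *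
                (φs (lam • x τ) + φ (m τ) - lam * ⟪m τ, x τ⟫))
        (-(((lam + γ) / (1 + ε * lam)) *
              ⟪(m t - ε • (α • f' (x t) + γ • m t)) - φs' (lam • x t),
                φ' (m t - ε • (α • f' (x t) + γ • m t)) - lam • x t⟫
            + ((1 - ε * γ) / (1 + ε * lam)) *
              ((1 / ε) * ⟪(m t - ε • (α • f' (x t) + γ • m t)) - m t,
                φ' (m t - ε • (α • f' (x t) + γ • m t)) - φ' (m t)⟫))) t := by
  refine ⟨(hsub t ht).inner_sub_nonneg hconv (hφ' _),
    mul_nonneg (by positivity) (hconv.inner_gradient_sub_nonneg (hφ' _) (hφ' _)), ?_⟩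
  have hs := (hφs' t ht).comp_hasDerivAt ((hx t).const_smul lam)
  have hH := ((((hf' (x t)).comp_hasDerivAt (hx t)).const_mul α).add
    (hs.const_mul (γ / lam))).add (((hs.add ((hφ' (m t)).comp_hasDerivAt (hm t))).sub
      (((hm t).inner ℝ (hx t)).const_mul lam)).const_mul ((1 - ε * γ) / (1 + ε * lam)))
  refine hH.congr_deriv ?_
  have hden : 1 + ε * lam ≠ 0 := by positivity
  generalize φ' (m t - ε • (α • f' (x t) + γ • m t)) = p
  simp only [inner_sub_left, inner_sub_right, inner_add_left, inner_neg_left,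
    inner_neg_right, real_inner_smul_left, real_inner_smul_right]
  simp only [real_inner_comm (f' (x t)), real_inner_comm (m t)]
  field_simp
  ring
end

section
/- Let α, γ, λ, ε > 0 with εγ ≤ 1, let f be continuously differentiable, φ and φ* differentiable, and define, for each (x,m): m̃ = m − ε(α∇f(x) + γm), V_x(x,m) = ∇φ(m̃) − λx, V_m(x,m) = −α∇f(x) − γm = (m̃ − m)/ε, V̂_x(x,m) = m̃ − ∇φ*(λx), V̂_m(x,m) = ∇φ(m̃) − ∇φ(m), and H(x,m) = α f(x) + (γ/λ) φ*(λx) + ((1−εγ)/(1+ελ)) ( φ*(λx) + φ(m) − λ mᵀx ). Then with η = (1−εγ)/(1+ελ) and η' = (γ+λ)/(1+ελ), the gradients of H decompose as ∇_x H(x,m) = −η' V̂_x(x,m) − η V_m(x,m) and ∇_m H(x,m) = −η V̂_m(x,m) + η V_x(x,m). Moreover V̂_xᵀV_x ≥ 0 and V̂_mᵀV_m ≥ 0 everywhere, so along the ODE ẋ = V_x, ṁ = V_m one has (d/dt) H(x_t,m_t) = −(η' V̂_xᵀV_x + η V̂_mᵀV_m) ≤ 0. -/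
open scoped RealInnerProductSpace

section Gradient

variable {E : Type*} [NormedAddCommGroup E] [InnerProductSpace ℝ E] [CompleteSpace E]

/-- Chain rule for a function with a gradient along a curve. -/
theorem HasGradientAt.comp_hasDerivAt_inner {F : E → ℝ} {c : ℝ → E} {g v : E} (t : ℝ)
    (hF : HasGradientAt F g (c t)) (hc : HasDerivAt c v t) :
    HasDerivAt (fun τ => F (c τ)) ⟪g, v⟫ t :=
  hF.hasFDerivAt.comp_hasDerivAt t hc

/-- First-order condition: a convex function lies above its tangent hyperplanes. -/
theorem ConvexOn.add_inner_gradient_le_s5 {F : E → ℝ} (hF : ConvexOn ℝ Set.univ F) {g a : E}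
    (hg : HasGradientAt F g a) (b : E) : F a + ⟪g, b - a⟫ ≤ F b := by
  have hline : HasDerivAt (fun t : ℝ => AffineMap.lineMap a b t) (b - a) 0 :=
    AffineMap.hasDerivAt_lineMap
  have hd : HasDerivAt (F ∘ AffineMap.lineMap a b) ⟪g, b - a⟫ (0 : ℝ) :=
    HasGradientAt.comp_hasDerivAt_inner 0 (by simpa using hg) hline
  have hc : ConvexOn ℝ Set.univ (F ∘ (AffineMap.lineMap a b : ℝ →ᵃ[ℝ] E)) :=
    hF.comp_affineMap _
  have h := hc.le_slope_of_hasDerivAt (Set.mem_univ _) (Set.mem_univ _) one_pos hd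
  simp only [slope_def_field, Function.comp_apply, AffineMap.lineMap_apply_one,
    AffineMap.lineMap_apply_zero, sub_zero, div_one] at h
  linarith

/-- The gradient of a convex function is monotone. -/
theorem ConvexOn.inner_gradient_sub_nonneg_s5 {F : E → ℝ} (hF : ConvexOn ℝ Set.univ F) {g h a b : E}
    (ha : HasGradientAt F g a) (hb : HasGradientAt F h b) : 0 ≤ ⟪g - h, a - b⟫ := by
  have h₁ := hF.add_inner_gradient_le_s5 ha b
  have h₂ := hF.add_inner_gradient_le_s5 hb a
  simp only [inner_sub_left, inner_sub_right] at h₁ h₂ ⊢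
  linarith

end Gradient

section Conjugate

variable {d : ℕ} {φ φs : EuclideanSpace ℝ (Fin d) → ℝ}

/-- Fenchel–Young inequality for a finite-valued conjugate. -/
theorem inner_sub_le_of_fenchelConj_eq (hφs : ∀ y, fenchelConj φ y = ((φs y : ℝ) : EReal))
    (y z : EuclideanSpace ℝ (Fin d)) : ⟪y, z⟫ - φ z ≤ φs y := by
  rw [← EReal.coe_le_coe_iff, ← hφs]
  exact le_iSup (fun z => ((⟪y, z⟫ - φ z : ℝ) : EReal)) z

theorem le_of_fenchelConj_eq (hφs : ∀ y, fenchelConj φ y = ((φs y : ℝ) : EReal))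
    {y : EuclideanSpace ℝ (Fin d)} {c : ℝ} (h : ∀ z, ⟪y, z⟫ - φ z ≤ c) : φs y ≤ c := by
  rw [← EReal.coe_le_coe_iff, ← hφs]
  exact iSup_le fun z => EReal.coe_le_coe_iff.2 (h z)

/-- A finite-valued conjugate is convex. -/
theorem convexOn_of_fenchelConj_eq (hφs : ∀ y, fenchelConj φ y = ((φs y : ℝ) : EReal)) :
    ConvexOn ℝ Set.univ φs := by
  refine ⟨convex_univ, fun x _ y _ a b ha hb hab => le_of_fenchelConj_eq hφs fun z => ?_⟩
  have hx := mul_le_mul_of_nonneg_left (inner_sub_le_of_fenchelConj_eq hφs x z) ha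
  have hy := mul_le_mul_of_nonneg_left (inner_sub_le_of_fenchelConj_eq hφs y z) hb
  have hz : φ z = a * φ z + b * φ z := by rw [← add_mul, hab, one_mul]
  simp only [inner_add_left, real_inner_smul_left, smul_eq_mul]
  linarith

/-- At a gradient of a convex function the Fenchel–Young inequality is an equality. -/
theorem fenchelConj_gradient_le (hconv : ConvexOn ℝ Set.univ φ)
    (hφs : ∀ y, fenchelConj φ y = ((φs y : ℝ) : EReal)) {g z : EuclideanSpace ℝ (Fin d)}
    (hg : HasGradientAt φ g z) : φs g ≤ ⟪g, z⟫ - φ z := by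
  refine le_of_fenchelConj_eq hφs fun w => ?_
  have h := hconv.add_inner_gradient_le_s5 hg w
  rw [inner_sub_right] at h
  linarith

/-- Monotonicity of the subdifferential of the conjugate, between the point `g = ∇φ(z)`, where `z`
is a subgradient, and a point `y` of differentiability. -/
theorem inner_sub_fenchelConj_gradient_nonneg (hconv : ConvexOn ℝ Set.univ φ)
    (hφs : ∀ y, fenchelConj φ y = ((φs y : ℝ) : EReal)) {g z h y : EuclideanSpace ℝ (Fin d)}
    (hg : HasGradientAt φ g z) (hh : HasGradientAt φs h y) : 0 ≤ ⟪z - h, g - y⟫ := by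
  have h₁ := fenchelConj_gradient_le hconv hφs hg
  have h₂ := inner_sub_le_of_fenchelConj_eq hφs y z
  have h₃ := (convexOn_of_fenchelConj_eq hφs).add_inner_gradient_le_s5 hh g
  rw [inner_sub_right] at h₃
  rw [real_inner_comm] at h₁ h₂
  simp only [inner_sub_left, inner_sub_right]
  linarith

end Conjugate

section Decomposition

variable {E : Type*} [AddCommGroup E] [Module ℝ E]

theorem position_gradient_decomposition {α γ lam ε : ℝ} (h : 1 + ε * lam ≠ 0) (a m s : E) :
    α • a + γ • s + ((1 - ε * γ) / (1 + ε * lam)) • (lam • s - lam • m)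
      = -(((γ + lam) / (1 + ε * lam)) • ((m - ε • (α • a + γ • m)) - s))
        - ((1 - ε * γ) / (1 + ε * lam)) • (-(α • a) - γ • m) := by
  have h₁ : (1 - ε * γ) / (1 + ε * lam) = 1 - ε * ((γ + lam) / (1 + ε * lam)) := by
    field_simp
    ring
  have h₂ : (γ + lam) / (1 + ε * lam) = γ + (1 - ε * γ) / (1 + ε * lam) * lam := by
    rw [div_eq_iff h, add_mul, mul_right_comm, div_mul_cancel₀ _ h]
    ring
  generalize (1 - ε * γ) / (1 + ε * lam) = η at h₁ h₂ ⊢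
  generalize (γ + lam) / (1 + ε * lam) = η' at h₁ h₂ ⊢
  match_scalars
  · linear_combination -α * h₁
  · linear_combination -h₂
  · linear_combination h₂ - γ * h₁

end Decomposition

/-- Implicit Hamiltonian + descent decomposition: with
`m̃ = m − ε(α∇f(x) + γm)`, `V_x = ∇φ(m̃) − λx`, `V_m = −α∇f(x) − γm`,
`V̂_x = m̃ − ∇φ*(λx)`, `V̂_m = ∇φ(m̃) − ∇φ(m)`, `η = (1−εγ)/(1+ελ)`,
`η' = (γ+λ)/(1+ελ)`, the gradients of
`H(x,m) = α f(x) + (γ/λ)φ*(λx) + η (φ*(λx) + φ(m) − λ mᵀx)` decompose as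
`∇ₓH = −η' V̂_x − η V_m`, `∇ₘH = −η V̂_m + η V_x`; moreover `V̂_xᵀV_x ≥ 0` and
`V̂_mᵀV_m ≥ 0`, so along the ODE `ẋ = V_x`, `ṁ = V_m` one has
`(d/dt) H(x_t,m_t) = −(η' V̂_xᵀV_x + η V̂_mᵀV_m) ≤ 0`. -/
theorem lion_implicit_hamiltonian_descent {d : ℕ}
    (φ f : EuclideanSpace ℝ (Fin d) → ℝ)
    (φ' f' : EuclideanSpace ℝ (Fin d) → EuclideanSpace ℝ (Fin d))
    (φs : EuclideanSpace ℝ (Fin d) → ℝ)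
    (φs' : EuclideanSpace ℝ (Fin d) → EuclideanSpace ℝ (Fin d))
    (hconv : ConvexOn ℝ Set.univ φ)
    (hφ' : ∀ z, HasGradientAt φ (φ' z) z)
    (hf' : ∀ z, HasGradientAt f (f' z) z) (hf'c : Continuous f')
    (hφs : ∀ y, fenchelConj φ y = ((φs y : ℝ) : EReal))
    (hφs' : ∀ y, HasGradientAt φs (φs' y) y)
    (α γ lam ε : ℝ) (hα : 0 < α) (hγ : 0 < γ) (hlam : 0 < lam) (hε : 0 < ε)
    (hεγ : ε * γ ≤ 1) :
    (∀ x m : EuclideanSpace ℝ (Fin d),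
        HasGradientAt
          (fun x' => α * f x' + (γ / lam) * φs (lam • x')
              + ((1 - ε * γ) / (1 + ε * lam)) *
                  (φs (lam • x') + φ m - lam * ⟪m, x'⟫))
          (-(((γ + lam) / (1 + ε * lam)) •
                ((m - ε • (α • f' x + γ • m)) - φs' (lam • x)))
            - ((1 - ε * γ) / (1 + ε * lam)) • (-(α • f' x) - γ • m)) x)
    ∧ (∀ x m : EuclideanSpace ℝ (Fin d),
        HasGradientAt
          (fun m' => α * f x + (γ / lam) * φs (lam • x)
              + ((1 - ε * γ) / (1 + ε * lam)) *
                  (φs (lam • x) + φ m' - lam * ⟪m', x⟫))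
          (-(((1 - ε * γ) / (1 + ε * lam)) •
                (φ' (m - ε • (α • f' x + γ • m)) - φ' m))
            + ((1 - ε * γ) / (1 + ε * lam)) •
                (φ' (m - ε • (α • f' x + γ • m)) - lam • x)) m)
    ∧ (∀ x m : EuclideanSpace ℝ (Fin d),
        0 ≤ ⟪(m - ε • (α • f' x + γ • m)) - φs' (lam • x),
              φ' (m - ε • (α • f' x + γ • m)) - lam • x⟫
        ∧ 0 ≤ ⟪φ' (m - ε • (α • f' x + γ • m)) - φ' m, -(α • f' x) - γ • m⟫)
    ∧ (∀ x m : ℝ → EuclideanSpace ℝ (Fin d),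
        (∀ t, HasDerivAt x
            (φ' (m t - ε • (α • f' (x t) + γ • m t)) - lam • x t) t) →
        (∀ t, HasDerivAt m (-(α • f' (x t)) - γ • m t) t) →
        ∀ t : ℝ,
          HasDerivAt
            (fun τ => α * f (x τ) + (γ / lam) * φs (lam • x τ)
                + ((1 - ε * γ) / (1 + ε * lam)) *
                    (φs (lam • x τ) + φ (m τ) - lam * ⟪m τ, x τ⟫))
            (-(((γ + lam) / (1 + ε * lam)) *
                  ⟪(m t - ε • (α • f' (x t) + γ • m t)) - φs' (lam • x t),
                    φ' (m t - ε • (α • f' (x t) + γ • m t)) - lam • x t⟫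
                + ((1 - ε * γ) / (1 + ε * lam)) *
                  ⟪φ' (m t - ε • (α • f' (x t) + γ • m t)) - φ' (m t),
                    -(α • f' (x t)) - γ • m t⟫)) t
          ∧ (-(((γ + lam) / (1 + ε * lam)) *
                  ⟪(m t - ε • (α • f' (x t) + γ • m t)) - φs' (lam • x t),
                    φ' (m t - ε • (α • f' (x t) + γ • m t)) - lam • x t⟫
                + ((1 - ε * γ) / (1 + ε * lam)) *
                  ⟪φ' (m t - ε • (α • f' (x t) + γ • m t)) - φ' (m t),
                    -(α • f' (x t)) - γ • m t⟫)) ≤ 0) := by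
  have hD : 0 < 1 + ε * lam := by positivity
  have hη : 0 ≤ (1 - ε * γ) / (1 + ε * lam) := div_nonneg (by linarith) hD.le
  have hη' : 0 ≤ (γ + lam) / (1 + ε * lam) := by positivity
  have hsign : ∀ x m : EuclideanSpace ℝ (Fin d),
      0 ≤ ⟪(m - ε • (α • f' x + γ • m)) - φs' (lam • x),
            φ' (m - ε • (α • f' x + γ • m)) - lam • x⟫
      ∧ 0 ≤ ⟪φ' (m - ε • (α • f' x + γ • m)) - φ' m, -(α • f' x) - γ • m⟫ := by
    refine fun x m =>
      ⟨inner_sub_fenchelConj_gradient_nonneg hconv hφs (hφ' _) (hφs' _), ?_⟩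
    have h := hconv.inner_gradient_sub_nonneg_s5 (hφ' (m - ε • (α • f' x + γ • m))) (hφ' m)
    have hstep : m - ε • (α • f' x + γ • m) - m = ε • (-(α • f' x) - γ • m) := by module
    rw [hstep, real_inner_smul_right] at h
    exact nonneg_of_mul_nonneg_right h hε
  refine ⟨fun x m => ?_, fun x m => ?_, hsign, fun x m hx hm t => ⟨?_, ?_⟩⟩
  · rw [← position_gradient_decomposition hD.ne']
    have hs : HasFDerivAt (fun x' => φs (lam • x')) _ x :=
      (hφs' (lam • x)).hasFDerivAt.comp x ((hasFDerivAt_id x).const_smul lam)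
    have hi : HasFDerivAt (fun x' => ⟪m, x'⟫) (innerSL ℝ m) x := (innerSL ℝ m).hasFDerivAt
    have H := (((hf' x).hasFDerivAt.const_mul α).add (hs.const_mul (γ / lam))).add
      (((hs.add_const (φ m)).sub (hi.const_mul lam)).const_mul ((1 - ε * γ) / (1 + ε * lam)))
    rw [hasGradientAt_iff_hasFDerivAt]
    refine H.congr_fderiv ?_
    ext v
    simp
    field_simp
  · have hi : HasFDerivAt (fun m' => ⟪m', x⟫) (innerSL ℝ x) m := by
      simpa only [real_inner_comm x] using! (innerSL ℝ x).hasFDerivAt (x := m)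
    have H := ((((hφ' m).hasFDerivAt.const_add (φs (lam • x))).sub
      (hi.const_mul lam)).const_mul ((1 - ε * γ) / (1 + ε * lam))).const_add
        (α * f x + (γ / lam) * φs (lam • x))
    rw [hasGradientAt_iff_hasFDerivAt]
    refine H.congr_fderiv ?_
    ext v
    simp
    ring
  · have hs := (hφs' (lam • x t)).comp_hasDerivAt_inner t ((hx t).const_smul lam)
    have H := ((((hf' (x t)).comp_hasDerivAt_inner t (hx t)).const_mul α).add
      (hs.const_mul (γ / lam))).add
      (((hs.add ((hφ' (m t)).comp_hasDerivAt_inner t (hm t))).sub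
        (((hm t).inner ℝ (hx t)).const_mul lam)).const_mul ((1 - ε * γ) / (1 + ε * lam)))
    refine H.congr_deriv ?_
    have key := congrArg
      (fun u => ⟪u, φ' (m t - ε • (α • f' (x t) + γ • m t)) - lam • x t⟫)
      (position_gradient_decomposition (α := α) (γ := γ) hD.ne' (f' (x t)) (m t) (φs' (lam • x t)))
    generalize φ' (m t - ε • (α • f' (x t) + γ • m t)) = p at key ⊢
    generalize m t - ε • (α • f' (x t) + γ • m t) - φs' (lam • x t) = q at key ⊢
    generalize -(α • f' (x t)) - γ • m t = v at key ⊢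
    generalize (1 - ε * γ) / (1 + ε * lam) = η at key ⊢
    obtain ⟨w, rfl⟩ : ∃ w, p = w + lam • x t := ⟨p - lam • x t, by module⟩
    have hcancel : ∀ r : ℝ, γ / lam * (lam * r) = γ * r := fun r => by field_simp
    simp only [add_sub_cancel_right, inner_add_left, inner_sub_left, inner_neg_left,
      real_inner_smul_left, real_inner_smul_right, hcancel] at key ⊢
    rw [real_inner_comm w v, real_inner_comm (x t) v] at *
    linear_combination key
  · obtain ⟨h₁, h₂⟩ := hsign (x t) (m t)
    exact neg_nonpos.2 (add_nonneg (mul_nonneg hη' h₁) (mul_nonneg hη h₂))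
end

section
/- Suppose f is twice continuously differentiable and φ* is twice differentiable with ∇φ and ∇φ* mutually inverse gradient maps. Then (x_t, m_t) solves the Lion-φ ODE ẋ_t = ∇φ(m_t − ε(α∇f(x_t) + γ m_t)) − λ x_t, ṁ_t = −α∇f(x_t) − γ m_t (with εγ < 1) if and only if x_t solves the second-order ODE ∇²φ*(ẋ_t + λ x_t)(ẍ_t + λ ẋ_t) + εα ∇²f(x_t) ẋ_t + γ ∇φ*(ẋ_t + λ x_t) + α ∇f(x_t) = 0 (with m_t recovered by (1−εγ) m_t = ∇φ*(ẋ_t + λ x_t) + εα∇f(x_t)). In particular, when φ(x) = ‖x‖²₂/2 (so ∇φ* = id), x_t satisfies ẍ_t + (λ+γ) ẋ_t + εα ∇²f(x_t) ẋ_t + γλ x_t + α∇f(x_t) = 0, in which the roles of γ and λ are symmetric. -/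
open scoped RealInnerProductSpace

/-- Lion-φ as a second-order ODE: suppose `f` is twice continuously
differentiable with Hessian `f''`, the conjugate `φ*` (denoted `φs`, with gradient
`φs' = ∇φ*` and second derivative `φs''`) is twice differentiable, and `∇φ`, `∇φ*` are
mutually inverse.  Then `(x_t, m_t)` solves the Lion-φ ODE (with `εγ < 1`) iff `x_t`
solves `∇²φ*(ẋ+λx)(ẍ+λẋ) + εα∇²f(x)ẋ + γ∇φ*(ẋ+λx) + α∇f(x) = 0`, with `m_t`
recovered from `(1−εγ)m = ∇φ*(ẋ+λx) + εα∇f(x)`.  In particular, when `∇φ* = id`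
(i.e. `φ = ‖·‖²/2`), `x_t` satisfies
`ẍ + (λ+γ)ẋ + εα∇²f(x)ẋ + γλx + α∇f(x) = 0`. -/
theorem lion_second_order_ode {d : ℕ}
    (φ f : EuclideanSpace ℝ (Fin d) → ℝ)
    (φ' f' : EuclideanSpace ℝ (Fin d) → EuclideanSpace ℝ (Fin d))
    (f'' : EuclideanSpace ℝ (Fin d) →
      EuclideanSpace ℝ (Fin d) →L[ℝ] EuclideanSpace ℝ (Fin d))
    (φs : EuclideanSpace ℝ (Fin d) → ℝ)
    (φs' : EuclideanSpace ℝ (Fin d) → EuclideanSpace ℝ (Fin d))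
    (φs'' : EuclideanSpace ℝ (Fin d) →
      EuclideanSpace ℝ (Fin d) →L[ℝ] EuclideanSpace ℝ (Fin d))
    (hconv : ConvexOn ℝ Set.univ φ)
    (hφ' : ∀ z, HasGradientAt φ (φ' z) z)
    (hf' : ∀ z, HasGradientAt f (f' z) z)
    (hf'' : ∀ z, HasFDerivAt f' (f'' z) z) (hf''c : Continuous f'')
    (hφs' : ∀ y, HasGradientAt φs (φs' y) y)
    (hφs'' : ∀ y, HasFDerivAt φs' (φs'' y) y)
    (hinv₁ : ∀ y, φ' (φs' y) = y) (hinv₂ : ∀ z, φs' (φ' z) = z)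
    (α γ lam ε : ℝ) (hα : 0 < α) (hγ : 0 < γ) (hlam : 0 < lam) (hε : 0 < ε)
    (hεγ : ε * γ < 1)
    (x x' x'' : ℝ → EuclideanSpace ℝ (Fin d))
    (hx' : ∀ t, HasDerivAt x (x' t) t)
    (hx'' : ∀ t, HasDerivAt x' (x'' t) t) :
    (∀ m : ℝ → EuclideanSpace ℝ (Fin d),
        (∀ t, x' t = φ' (m t - ε • (α • f' (x t) + γ • m t)) - lam • x t) →
        (∀ t, HasDerivAt m (-(α • f' (x t)) - γ • m t) t) →
        (∀ t, φs'' (x' t + lam • x t) (x'' t + lam • x' t)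
            + (ε * α) • f'' (x t) (x' t)
            + γ • φs' (x' t + lam • x t) + α • f' (x t) = 0)
        ∧ (∀ t, (1 - ε * γ) • m t = φs' (x' t + lam • x t) + (ε * α) • f' (x t)))
    ∧ ((∀ t, φs'' (x' t + lam • x t) (x'' t + lam • x' t)
            + (ε * α) • f'' (x t) (x' t)
            + γ • φs' (x' t + lam • x t) + α • f' (x t) = 0) →
        ∃ m : ℝ → EuclideanSpace ℝ (Fin d),
          (∀ t, x' t = φ' (m t - ε • (α • f' (x t) + γ • m t)) - lam • x t)
          ∧ (∀ t, HasDerivAt m (-(α • f' (x t)) - γ • m t) t))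
    ∧ ((∀ y, φs' y = y) →
        ((∀ t, φs'' (x' t + lam • x t) (x'' t + lam • x' t)
              + (ε * α) • f'' (x t) (x' t)
              + γ • φs' (x' t + lam • x t) + α • f' (x t) = 0)
          ↔ (∀ t, x'' t + (lam + γ) • x' t + (ε * α) • f'' (x t) (x' t)
              + (γ * lam) • x t + α • f' (x t) = 0))) := by
  have hc : (1 - ε * γ) ≠ 0 := by linarith
  have hy : ∀ t, HasDerivAt (fun t => φs' (x' t + lam • x t) + (ε * α) • f' (x t))
      (φs'' (x' t + lam • x t) (x'' t + lam • x' t) + (ε * α) • f'' (x t) (x' t)) t := fun t =>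
    ((hφs'' _).comp_hasDerivAt t ((hx'' t).add ((hx' t).const_smul lam))).add
      (((hf'' (x t)).comp_hasDerivAt t (hx' t)).const_smul (ε * α))
  refine ⟨fun m hxm hm => ?_, fun hode => ?_, fun hid => ?_⟩
  · have hrec : ∀ t, (1 - ε * γ) • m t = φs' (x' t + lam • x t) + (ε * α) • f' (x t) := by
      intro t
      have h : x' t + lam • x t = φ' (m t - ε • (α • f' (x t) + γ • m t)) := by
        conv_lhs => rw [hxm t]
        abel
      rw [h, hinv₂]
      module
    refine ⟨fun t => ?_, hrec⟩
    have hd := (hm t).const_smul (1 - ε * γ)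
    have heq : (1 - ε * γ) • m = fun t => φs' (x' t + lam • x t) + (ε * α) • f' (x t) :=
      funext hrec
    rw [heq] at hd
    have hu := (hy t).unique hd
    have hr := hrec t
    linear_combination (norm := module) hu - γ • hr
  · have hrec : ∀ t, (1 - ε * γ) • ((1 - ε * γ)⁻¹ •
        (φs' (x' t + lam • x t) + (ε * α) • f' (x t))) =
          φs' (x' t + lam • x t) + (ε * α) • f' (x t) := fun t => smul_inv_smul₀ hc _
    refine ⟨fun t => (1 - ε * γ)⁻¹ • (φs' (x' t + lam • x t) + (ε * α) • f' (x t)),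
      fun t => ?_, fun t => ?_⟩
    · have h := hrec t
      have h' : (1 - ε * γ)⁻¹ • (φs' (x' t + lam • x t) + (ε * α) • f' (x t)) -
          ε • (α • f' (x t) + γ • ((1 - ε * γ)⁻¹ •
            (φs' (x' t + lam • x t) + (ε * α) • f' (x t)))) = φs' (x' t + lam • x t) := by
        generalize (1 - ε * γ)⁻¹ • (φs' (x' t + lam • x t) + (ε * α) • f' (x t)) = w at h ⊢
        linear_combination (norm := module) h
      rw [h', hinv₁]
      abel
    · refine ((hy t).const_smul (1 - ε * γ)⁻¹).congr_deriv ?_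
      have h := hrec t
      have ho := hode t
      rw [inv_smul_eq_iff₀ hc]
      beta_reduce
      generalize (1 - ε * γ)⁻¹ • (φs' (x' t + lam • x t) + (ε * α) • f' (x t)) = w at h ⊢
      linear_combination (norm := module) ho + γ • h
  · have hid' : ∀ y, φs'' y = ContinuousLinearMap.id ℝ _ := fun y =>
      (hφs'' y).unique (by rw [show φs' = id from funext hid]; exact hasFDerivAt_id y)
    refine forall_congr' fun t => ?_
    rw [hid', hid, ContinuousLinearMap.id_apply]
    refine Eq.congr ?_ rfl
    module
end
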